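/- Let n ≥ 2, let D ⊆ ℝⁿ be open, let μ > 0, and let u : D → ℝ be continuous. Then u is μ-panharmonic on D if and only if u has the average property: for every x ∈ D and r > 0 with the closed ball B̄(x,r) contained in D, u(x) = ψ_n(μr) · ∫_{∂B(x,r)} u(y) σ(x,r; dy). -/

import Mathlib

open Set MeasureTheory
open scoped ENNReal

noncomputable section


/-- Second derivative of `f` at `x` in direction `v`. -/
def secondDeriv {E : Type*} [NormedAddCommGroup E] [NormedSpace ℝ E]
    (f : E → ℝ) (x v : E) : ℝ :=
  fderiv ℝ (fun y => fderiv ℝ f y v) x v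

/-- The Laplace operator on `ℝⁿ`: `Δf = ∑ i, ∂²f/∂xᵢ²`. -/
def laplacian {n : ℕ} (f : EuclideanSpace ℝ (Fin n) → ℝ) (x : EuclideanSpace ℝ (Fin n)) : ℝ :=
  ∑ i : Fin n, secondDeriv f x (EuclideanSpace.single i 1)

/-- The Laplace operator on `ℝⁿ × ℝ ≅ ℝ^{n+1}`:
`ΔF = ∑ i, ∂²F/∂xᵢ² + ∂²F/∂t²`. -/
def laplacianProd {n : ℕ} (F : EuclideanSpace ℝ (Fin n) × ℝ → ℝ)
    (p : EuclideanSpace ℝ (Fin n) × ℝ) : ℝ :=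
  (∑ i : Fin n, secondDeriv F p (EuclideanSpace.single i 1, (0 : ℝ))) +
    secondDeriv F p (0, 1)

/-- `ψ_n(μ) = μ^ν / (2^ν Γ(ν+1) I_ν(μ))` with `ν = (n-2)/2`, where
`I_ν(x) = ∑_{m=0}^∞ (x/2)^{2m+ν}/(m! Γ(m+ν+1))` is the modified Bessel function of
the first kind.  Cancelling the factor `(μ/2)^ν` this reads
`ψ_n(μ) = (∑_{m=0}^∞ (μ²/4)^m Γ(ν+1)/(m! Γ(m+ν+1)))⁻¹`, with `ν + 1 = n/2`;
in particular `ψ_n(0) = 1`. -/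
noncomputable def psi (n : ℕ) (μ : ℝ) : ℝ :=
  (∑' m : ℕ, (μ ^ 2 / 4) ^ m *
      (Real.Gamma ((n : ℝ) / 2) / (m.factorial * Real.Gamma ((m : ℝ) + (n : ℝ) / 2))))⁻¹

/-- The uniform (normalized) probability measure `σ(x,r;·)` on the sphere
`∂B(x,r) ⊆ ℝⁿ`, obtained by normalizing the `(n-1)`-dimensional Hausdorff measure. -/
def sphereUniform (n : ℕ) (x : EuclideanSpace ℝ (Fin n)) (r : ℝ) :
    MeasureTheory.Measure (EuclideanSpace ℝ (Fin n)) :=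
  (μH[(n : ℝ) - 1] (Metric.sphere x r))⁻¹ • μH[(n : ℝ) - 1].restrict (Metric.sphere x r)

/-- The radial projection to the sphere of centre `x` and radius `r` of a face of a cube. -/
def cubeFaceToSphere {m : ℕ} (x : EuclideanSpace ℝ (Fin (m + 1))) (r : ℝ) (i : Fin (m + 1))
    (s : ℝ) (z : Fin m → ℝ) : EuclideanSpace ℝ (Fin (m + 1)) :=
  x + r • (‖WithLp.toLp 2 (i.insertNth (α := fun _ => ℝ) s z)‖⁻¹ •
    WithLp.toLp 2 (i.insertNth (α := fun _ => ℝ) s z))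

lemma contDiff_cubeFaceToSphere {m : ℕ} (x : EuclideanSpace ℝ (Fin (m + 1))) (r : ℝ)
    (i : Fin (m + 1)) {s : ℝ} (hs : s ≠ 0) : ContDiff ℝ 1 (cubeFaceToSphere x r i s) := by
  have hw : ContDiff ℝ 1 (fun z : Fin m → ℝ =>
      (WithLp.toLp 2 (i.insertNth (α := fun _ => ℝ) s z) : EuclideanSpace ℝ (Fin (m + 1)))) := by
    rw [contDiff_euclidean]
    intro j
    induction j using i.succAboveCases with
    | x => simpa using contDiff_const
    | p j => simpa using contDiff_apply ℝ ℝ j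
  have h0 : ∀ z : Fin m → ℝ,
      (WithLp.toLp 2 (i.insertNth (α := fun _ => ℝ) s z) : EuclideanSpace ℝ (Fin (m + 1))) ≠ 0 := by
    intro z h
    have := congrArg (fun w : EuclideanSpace ℝ (Fin (m + 1)) => w i) h
    simp at this
    exact hs this
  unfold cubeFaceToSphere
  have hinv := (hw.norm ℝ h0).inv fun z => norm_ne_zero_iff.2 (h0 z)
  exact contDiff_const.add ((hinv.smul hw).const_smul r)

lemma sphere_subset_cubeFaceToSphere {m : ℕ} (x : EuclideanSpace ℝ (Fin (m + 1))) {r : ℝ}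
    (hr : 0 < r) : Metric.sphere x r ⊆
      ⋃ i : Fin (m + 1), ⋃ s ∈ ({1, -1} : Set ℝ), cubeFaceToSphere x r i s '' Icc (-1) 1 := by
  intro y hy
  have hyr : ‖y - x‖ = r := by simpa [dist_eq_norm] using hy
  obtain ⟨i, hi⟩ := Finite.exists_max (fun i => |(y - x) i|)
  have hpos : 0 < |(y - x) i| := by
    by_contra! h
    have : y - x = 0 := by
      ext j
      have := (hi j).trans h
      simpa using abs_nonpos_iff.1 this
    rw [this] at hyr
    simp at hyr
    linarith
  set a := |(y - x) i| with ha
  have hs : (y - x) i / a ∈ ({1, -1} : Set ℝ) := by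
    rcases abs_choice ((y - x) i) with h | h
    · left
      rw [← ha] at h
      rw [← h]; field_simp
    · right
      rw [← ha] at h
      have : (y - x) i = - a := by linarith
      rw [this, mem_singleton_iff]; field_simp
  refine mem_iUnion.2 ⟨i, mem_iUnion₂.2 ⟨(y - x) i / a, hs, fun j => (y - x) (i.succAbove j) / a,
    ⟨?_, ?_⟩, ?_⟩⟩
  · intro j
    have := (abs_le.1 (hi (i.succAbove j))).1
    rw [Pi.neg_apply, Pi.one_apply, le_div_iff₀ hpos]
    linarith
  · intro j
    have := (abs_le.1 (hi (i.succAbove j))).2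
    rw [Pi.one_apply, div_le_iff₀ hpos]
    linarith
  · have hw : (WithLp.toLp 2 (i.insertNth (α := fun _ => ℝ) ((y - x) i / a)
        (fun j => (y - x) (i.succAbove j) / a)) : EuclideanSpace ℝ (Fin (m + 1)))
        = a⁻¹ • (y - x) := by
      ext j
      induction j using i.succAboveCases with
      | x => simp [div_eq_inv_mul]
      | p j => simp [div_eq_inv_mul]
    rw [cubeFaceToSphere, hw, norm_smul, hyr, smul_smul, smul_smul]
    have : r * (‖a⁻¹‖ * r)⁻¹ * a⁻¹ = 1 := by
      rw [Real.norm_of_nonneg (by positivity)]; field_simp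
    rw [this]; simp

lemma hausdorffMeasure_sphere_lt_top {m : ℕ} (x : EuclideanSpace ℝ (Fin (m + 1))) {r : ℝ}
    (hr : 0 < r) : μH[(m : ℝ)] (Metric.sphere x r) < ∞ := by
  refine (measure_mono (sphere_subset_cubeFaceToSphere x hr)).trans_lt ?_
  refine (measure_iUnion_le _).trans_lt ?_
  rw [tsum_fintype]
  refine ENNReal.sum_lt_top.2 fun i _ => ?_
  refine (measure_biUnion_lt_top (by simp) fun s hs => ?_)
  have hs0 : s ≠ 0 := by
    rcases hs with rfl | hs
    · simp
    · rw [mem_singleton_iff.1 hs]; simp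
  obtain ⟨K, hK⟩ := ((contDiff_cubeFaceToSphere x r i hs0).contDiffOn
    (s := Icc (-1) 1)).exists_lipschitzOnWith (by simp) (convex_Icc _ _) isCompact_Icc
  refine (hK.hausdorffMeasure_image_le (Nat.cast_nonneg m)).trans_lt ?_
  have h := hausdorffMeasure_pi_real (ι := Fin m)
  rw [Fintype.card_fin] at h
  rw [h]
  exact ENNReal.mul_lt_top (by simp) isCompact_Icc.measure_lt_top

lemma hausdorffMeasure_sphere_pos {m : ℕ} (x : EuclideanSpace ℝ (Fin (m + 1))) {r : ℝ}
    (hr : 0 < r) : 0 < μH[(m : ℝ)] (Metric.sphere x r) := by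
  set P : EuclideanSpace ℝ (Fin (m + 1)) → Fin m → ℝ := fun y i => y i.succ with hP
  have hL : LipschitzWith 1 P := by
    refine LipschitzWith.of_dist_le_mul fun y z => ?_
    rw [dist_pi_le_iff (by positivity)]
    intro i
    simp only [NNReal.coe_one, one_mul, hP, dist_eq_norm]
    exact PiLp.norm_apply_le (y - z) i.succ
  have h := hausdorffMeasure_pi_real (ι := Fin m)
  rw [Fintype.card_fin] at h
  have hle := hL.hausdorffMeasure_image_le (Nat.cast_nonneg (α := ℝ) m) (Metric.sphere x r)
  simp only [ENNReal.coe_one, ENNReal.one_rpow, one_mul] at hle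
  refine lt_of_lt_of_le ?_ hle
  rw [h]
  have hδ : 0 < r / (m + 1) := by positivity
  refine (Metric.measure_ball_pos volume (P x) hδ).trans_le (measure_mono ?_)
  intro z hz
  have hz' : ∀ i, |z i - P x i| ≤ r / (m + 1) := fun i => by
    have := (dist_pi_lt_iff hδ).1 hz i
    exact this.le
  have hsum : ∑ i, (z i - P x i) ^ 2 ≤ r ^ 2 := by
    calc ∑ i, (z i - P x i) ^ 2 ≤ ∑ i : Fin m, (r / (m + 1)) ^ 2 := by
          refine Finset.sum_le_sum fun i _ => ?_
          exact sq_le_sq' (abs_le.1 (hz' i)).1 (abs_le.1 (hz' i)).2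
      _ = m * (r / (m + 1)) ^ 2 := by simp
      _ ≤ r ^ 2 := by
          rw [div_pow, mul_div_assoc', div_le_iff₀ (by positivity)]
          have : (0 : ℝ) ≤ m := Nat.cast_nonneg m
          nlinarith [sq_nonneg r, mul_nonneg (sq_nonneg r) this, mul_nonneg (sq_nonneg r) (mul_nonneg this this)]
  refine ⟨WithLp.toLp 2 (Fin.cons (x 0 + √(r ^ 2 - ∑ i, (z i - P x i) ^ 2)) z), ?_, ?_⟩
  · rw [mem_sphere_iff_norm, EuclideanSpace.norm_eq, Fin.sum_univ_succ]
    simp only [PiLp.sub_apply, Fin.cons_zero, Fin.cons_succ, Real.norm_eq_abs, sq_abs,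
      add_sub_cancel_left]
    rw [Real.sq_sqrt (by linarith)]
    simp only [hP, sub_add_cancel]
    exact Real.sqrt_sq hr.le
  · ext i
    simp [hP]

section RotationInvariant

variable {E : Type*} [NormedAddCommGroup E] [InnerProductSpace ℝ E] [FiniteDimensional ℝ E]
  [MeasurableSpace E] [BorelSpace E]

omit [FiniteDimensional ℝ E] in
lemma measure_ball_eq_of_norm_eq {ν : Measure E} (hν : ∀ g : E ≃ₗᵢ[ℝ] E, ν.map g = ν)
    {a b : E} (hab : ‖a‖ = ‖b‖) (ε : ℝ) : ν (Metric.ball a ε) = ν (Metric.ball b ε) := by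
  set g := (ℝ ∙ (a - b))ᗮ.reflection with hg
  have hgab : g a = b := Submodule.reflection_sub hab
  have hpre : g ⁻¹' Metric.ball b ε = Metric.ball a ε := by
    rw [← hgab]
    exact g.isometry.preimage_ball a ε
  rw [← hpre, ← Measure.map_apply g.continuous.measurable measurableSet_ball, hν g]

lemma measure_ball_pos_of_invariant {ν : Measure E} [IsProbabilityMeasure ν]
    (hν : ∀ g : E ≃ₗᵢ[ℝ] E, ν.map g = ν) (hs : ν (Metric.sphere 0 1)ᶜ = 0)
    {a : E} (ha : ‖a‖ = 1) {ε : ℝ} (hε : 0 < ε) : 0 < ν (Metric.ball a ε) := by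
  by_contra! h
  obtain ⟨t, hts, htf, hcov⟩ := (isCompact_sphere (0 : E) 1).finite_cover_balls hε
  have h0 : ν (Metric.sphere (0 : E) 1) = 0 := by
    refine measure_mono_null hcov ((measure_biUnion_null_iff htf.countable).2 fun b hb => ?_)
    have hb1 : ‖b‖ = 1 := by simpa using hts hb
    rw [measure_ball_eq_of_norm_eq hν (hb1.trans ha.symm)]
    exact le_antisymm h bot_le
  have h1 : ν univ ≤ 0 := by
    rw [← union_compl_self (Metric.sphere (0 : E) 1)]
    exact (measure_union_le _ _).trans (by rw [h0, hs, add_zero])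
  simp at h1

/-- A rotation invariant probability measure on the unit sphere is unique. -/
theorem eq_of_rotation_invariant {ν₁ ν₂ : Measure E} [IsProbabilityMeasure ν₁]
    [IsProbabilityMeasure ν₂] (h₁ : ∀ g : E ≃ₗᵢ[ℝ] E, ν₁.map g = ν₁)
    (h₂ : ∀ g : E ≃ₗᵢ[ℝ] E, ν₂.map g = ν₂) (hs₁ : ν₁ (Metric.sphere 0 1)ᶜ = 0)
    (hs₂ : ν₂ (Metric.sphere 0 1)ᶜ = 0) : ν₁ = ν₂ := by
  have hae₁ : ∀ᵐ a ∂ν₁, ‖a‖ = 1 := by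
    filter_upwards [measure_eq_zero_iff_ae_notMem.1 hs₁] with a ha
    simpa using ha
  have hae₂ : ∀ᵐ a ∂ν₂, ‖a‖ = 1 := by
    filter_upwards [measure_eq_zero_iff_ae_notMem.1 hs₂] with a ha
    simpa using ha
  obtain ⟨a, ha⟩ := hae₁.exists
  refine ext_of_forall_integral_eq_of_IsFiniteMeasure fun f => ?_
  refine eq_of_forall_dist_le fun δ hδ => ?_
  obtain ⟨ε, hε, hfε⟩ := Metric.uniformContinuousOn_iff.1
    ((isCompact_sphere (0 : E) 1).uniformContinuousOn_of_continuous f.continuous.continuousOn) δ hδ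
  set U : Set (E × E) := {p | dist p.1 p.2 < ε} with hU
  have hUm : MeasurableSet U := (isOpen_lt (by fun_prop) continuous_const).measurableSet
  have hU1 : ∀ (ν : Measure E) (_ : ∀ g : E ≃ₗᵢ[ℝ] E, ν.map g = ν) (c : ℝ) (b : E) (_ : ‖b‖ = 1),
      ∫ y, U.indicator (fun _ => c) (b, y) ∂ν = ν.real (Metric.ball a ε) * c := by
    intro ν hν c b hb
    have : (fun y => U.indicator (fun _ => c) (b, y)) = (Metric.ball b ε).indicator fun _ => c := by
      ext y
      simp [indicator, hU, Metric.mem_ball, dist_comm]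
    rw [this, integral_indicator measurableSet_ball, setIntegral_const, smul_eq_mul, measureReal_def,
      measure_ball_eq_of_norm_eq hν (hb.trans ha.symm), measureReal_def]
  have hU2 : ∀ (ν : Measure E) (_ : ∀ g : E ≃ₗᵢ[ℝ] E, ν.map g = ν) (c : ℝ) (b : E) (_ : ‖b‖ = 1),
      ∫ y, U.indicator (fun _ => c) (y, b) ∂ν = ν.real (Metric.ball a ε) * c := by
    intro ν hν c b hb
    rw [← hU1 ν hν c b hb]
    simp [indicator, hU, dist_comm]
  have hint : ∀ g : E × E → ℝ, Continuous g → (∃ C, ∀ p, ‖g p‖ ≤ C) →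
      Integrable (U.indicator g) (ν₁.prod ν₂) := fun g hg ⟨C, hC⟩ =>
    (Integrable.of_bound hg.aestronglyMeasurable C (.of_forall hC)).indicator hUm
  have hf1 := hint (fun p => f p.1) (by fun_prop) ⟨‖f‖, fun p => f.norm_coe_le_norm _⟩
  have hf2 := hint (fun p => f p.2) (by fun_prop) ⟨‖f‖, fun p => f.norm_coe_le_norm _⟩
  have hc := hint (fun _ => δ) (by fun_prop) ⟨‖δ‖, fun p => le_rfl⟩
  have I1 : ∫ p, U.indicator (fun p => f p.1) p ∂(ν₁.prod ν₂)
      = ν₂.real (Metric.ball a ε) * ∫ x, f x ∂ν₁ := by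
    rw [integral_prod _ hf1, ← integral_const_mul]
    refine integral_congr_ae ?_
    filter_upwards [hae₁] with x hx
    rw [← hU1 ν₂ h₂ (f x) x hx]
    simp [indicator]
  have I2 : ∫ p, U.indicator (fun p => f p.2) p ∂(ν₁.prod ν₂)
      = ν₁.real (Metric.ball a ε) * ∫ x, f x ∂ν₂ := by
    rw [integral_prod_symm _ hf2, ← integral_const_mul]
    refine integral_congr_ae ?_
    filter_upwards [hae₂] with x hx
    rw [← hU2 ν₁ h₁ (f x) x hx]
    simp [indicator]
  have I3 : ∫ p, U.indicator (fun _ => δ) p ∂(ν₁.prod ν₂) = ν₂.real (Metric.ball a ε) * δ := by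
    rw [integral_prod _ hc]
    calc _ = ∫ x, ν₂.real (Metric.ball a ε) * δ ∂ν₁ := by
          refine integral_congr_ae ?_
          filter_upwards [hae₁] with x hx
          exact hU1 ν₂ h₂ δ x hx
      _ = _ := by simp
  have I4 : ∫ p, U.indicator (fun _ => δ) p ∂(ν₁.prod ν₂) = ν₁.real (Metric.ball a ε) * δ := by
    rw [integral_prod_symm _ hc]
    calc _ = ∫ x, ν₁.real (Metric.ball a ε) * δ ∂ν₂ := by
          refine integral_congr_ae ?_
          filter_upwards [hae₂] with x hx
          exact hU2 ν₁ h₁ δ x hx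
      _ = _ := by simp
  have hκ : ν₁.real (Metric.ball a ε) = ν₂.real (Metric.ball a ε) :=
    mul_right_cancel₀ hδ.ne' (I4.symm.trans I3)
  have hκpos : 0 < ν₂.real (Metric.ball a ε) :=
    ENNReal.toReal_pos (measure_ball_pos_of_invariant h₂ hs₂ ha hε).ne' (measure_ne_top _ _)
  have hmain : ‖∫ p, (U.indicator (fun p => f p.1) p - U.indicator (fun p => f p.2) p)
      ∂(ν₁.prod ν₂)‖ ≤ ∫ p, U.indicator (fun _ => δ) p ∂(ν₁.prod ν₂) := by
    refine norm_integral_le_of_norm_le hc ?_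
    have e1 : ∀ᵐ p ∂(ν₁.prod ν₂), ‖p.1‖ = 1 := Measure.quasiMeasurePreserving_fst.ae hae₁
    have e2 : ∀ᵐ p ∂(ν₁.prod ν₂), ‖p.2‖ = 1 := Measure.quasiMeasurePreserving_snd.ae hae₂
    filter_upwards [e1, e2] with p hp1 hp2
    by_cases hp : p ∈ U
    · simp only [indicator_of_mem hp]
      exact (hfε p.1 (by simpa using hp1) p.2 (by simpa using hp2) hp).le
    · simp [indicator_of_notMem hp]
  rw [integral_sub hf1 hf2, I1, I2, I3, hκ, ← mul_sub, norm_mul, Real.norm_of_nonneg hκpos.le] at hmain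
  exact le_of_mul_le_mul_left hmain hκpos

open scoped Pointwise in
lemma map_toSphere_invariant (g : E ≃ₗᵢ[ℝ] E) :
    (((volume : Measure E).toSphere).map Subtype.val).map g
      = ((volume : Measure E).toSphere).map Subtype.val := by
  ext s hs
  have hgm := g.continuous.measurable
  rw [Measure.map_apply hgm hs, Measure.map_apply measurable_subtype_coe (hgm hs),
    Measure.map_apply measurable_subtype_coe hs,
    Measure.toSphere_apply' _ (measurable_subtype_coe (hgm hs)),
    Measure.toSphere_apply' _ (measurable_subtype_coe hs), Subtype.image_preimage_coe,
    Subtype.image_preimage_coe]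
  congr 1
  have : Ioo (0 : ℝ) 1 • (Metric.sphere (0 : E) 1 ∩ g ⁻¹' s)
      = g ⁻¹' (Ioo (0 : ℝ) 1 • (Metric.sphere (0 : E) 1 ∩ s)) := by
    ext y
    constructor
    · rintro ⟨t, ht, w, ⟨hw1, hw2⟩, rfl⟩
      exact ⟨t, ht, g w, ⟨by simpa using hw1, hw2⟩, by simp⟩
    · rintro ⟨t, ht, w, ⟨hw1, hw2⟩, hw⟩
      refine ⟨t, ht, g.symm w, ⟨by simpa using hw1, by simpa using hw2⟩, ?_⟩
      apply g.injective
      simpa using hw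
  rw [this]
  exact g.measurePreserving.measure_preimage_emb g.toHomeomorph.measurableEmbedding _

end RotationInvariant

lemma isProbabilityMeasure_sphereUniform {n : ℕ} (hn : 1 ≤ n) (x : EuclideanSpace ℝ (Fin n)) {r : ℝ}
    (hr : 0 < r) : IsProbabilityMeasure (sphereUniform n x r) := by
  obtain ⟨m, rfl⟩ : ∃ m, n = m + 1 := ⟨n - 1, by omega⟩
  constructor
  have h : ((m + 1 : ℕ) : ℝ) - 1 = m := by push_cast; ring
  rw [sphereUniform, h, Measure.smul_apply, Measure.restrict_apply_univ, smul_eq_mul]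
  exact ENNReal.inv_mul_cancel (hausdorffMeasure_sphere_pos x hr).ne'
    (hausdorffMeasure_sphere_lt_top x hr).ne

lemma map_sphereUniform_invariant {n : ℕ} (x : EuclideanSpace ℝ (Fin n)) (r : ℝ)
    (e : EuclideanSpace ℝ (Fin n) ≃ᵢ EuclideanSpace ℝ (Fin n)) (he : e x = x) :
    (sphereUniform n x r).map e = sphereUniform n x r := by
  rw [sphereUniform, Measure.map_smul]
  congr 1
  have h := (e.measurePreserving_hausdorffMeasure ((n : ℝ) - 1)).restrict_preimage
    (s := Metric.sphere x r) Metric.isClosed_sphere.measurableSet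
  have hpre : e ⁻¹' Metric.sphere x r = Metric.sphere x r := by
    conv_lhs => rw [← he]
    exact e.isometry.preimage_sphere x r
  rw [hpre] at h
  exact h.map_eq

/-- The uniform measure on a sphere in terms of `MeasureTheory.Measure.toSphere`. -/
theorem integral_sphereUniform {n : ℕ} (hn : 1 ≤ n) (x : EuclideanSpace ℝ (Fin n)) {r : ℝ}
    (hr : 0 < r) (u : EuclideanSpace ℝ (Fin n) → ℝ) :
    ∫ y, u y ∂(sphereUniform n x r) =
      ((volume : Measure (EuclideanSpace ℝ (Fin n))).toSphere.real univ)⁻¹ *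
        ∫ ω, u (x + r • ω.1) ∂(volume : Measure (EuclideanSpace ℝ (Fin n))).toSphere := by
  have := isProbabilityMeasure_sphereUniform hn x hr
  have : Nonempty (Fin n) := ⟨⟨0, hn⟩⟩
  set τ := (volume : Measure (EuclideanSpace ℝ (Fin n))).toSphere with hτ
  have hτ0 : τ univ ≠ 0 := by
    simp only [hτ, Measure.toSphere_apply_univ, finrank_euclideanSpace, Fintype.card_fin]
    exact mul_ne_zero (Nat.cast_ne_zero.2 (by omega)) (Metric.measure_ball_pos volume _ one_pos).ne'
  set A := (Homeomorph.addRight (-x)).trans (Homeomorph.smulOfNeZero r⁻¹ (inv_ne_zero hr.ne')) with hA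
  have hAy : ∀ y, A y = r⁻¹ • (y - x) := fun y => by simp [hA, sub_eq_add_neg]
  have hAinv : ∀ y, x + r • A y = y := fun y => by
    rw [hAy, smul_smul, mul_inv_cancel₀ hr.ne', one_smul, add_sub_cancel]
  have hAm : Measurable A := A.continuous.measurable
  have hp2 : IsProbabilityMeasure ((τ univ)⁻¹ • τ.map Subtype.val) := by
    constructor
    rw [Measure.smul_apply, Measure.map_apply measurable_subtype_coe .univ, preimage_univ,
      smul_eq_mul]
    exact ENNReal.inv_mul_cancel hτ0 (measure_ne_top _ _)
  have hp1 : IsProbabilityMeasure ((sphereUniform n x r).map A) :=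
    Measure.isProbabilityMeasure_map hAm.aemeasurable
  have key : (sphereUniform n x r).map A = (τ univ)⁻¹ • τ.map Subtype.val := by
    refine eq_of_rotation_invariant ?_ ?_ ?_ ?_
    · intro g
      set e : EuclideanSpace ℝ (Fin n) ≃ᵢ EuclideanSpace ℝ (Fin n) :=
        ((IsometryEquiv.addRight (-x)).trans g.toIsometryEquiv).trans (IsometryEquiv.addRight x)
        with he
      have hey : ∀ y, e y = g (y - x) + x := fun y => by simp [he, sub_eq_add_neg]
      have h := map_sphereUniform_invariant x r e (by rw [hey]; simp)
      conv_rhs => rw [← h]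
      rw [Measure.map_map g.continuous.measurable hAm, Measure.map_map hAm e.continuous.measurable]
      congr 1
      ext1 y
      simp [hAy, hey]
    · intro g
      rw [Measure.map_smul, map_toSphere_invariant]
    · rw [Measure.map_apply hAm Metric.isClosed_sphere.measurableSet.compl, preimage_compl]
      have : A ⁻¹' Metric.sphere 0 1 = Metric.sphere x r := by
        ext y
        rw [mem_preimage, hAy, mem_sphere_zero_iff_norm, norm_smul, mem_sphere_iff_norm,
          Real.norm_of_nonneg (by positivity), inv_mul_eq_one₀ hr.ne', eq_comm]
      rw [this, sphereUniform, Measure.smul_apply, Measure.restrict_apply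
        Metric.isClosed_sphere.measurableSet.compl]
      simp
    · rw [Measure.smul_apply, Measure.map_apply measurable_subtype_coe
        Metric.isClosed_sphere.measurableSet.compl]
      simp
  calc ∫ y, u y ∂(sphereUniform n x r) = ∫ y, u (x + r • A y) ∂(sphereUniform n x r) := by
        simp only [hAinv]
    _ = ∫ w, u (x + r • w) ∂((sphereUniform n x r).map A) :=
        (A.measurableEmbedding.integral_map fun w => u (x + r • w)).symm
    _ = _ := by
        rw [key, integral_smul_measure, (MeasurableEmbedding.subtype_coe
          Metric.isClosed_sphere.measurableSet).integral_map, ENNReal.toReal_inv, smul_eq_mul]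
        rfl

/-- Differentiation under the integral sign over a compact space. -/
lemma hasDerivAt_integral_of_compactSpace {K : Type*} [TopologicalSpace K] [CompactSpace K]
    [MeasurableSpace K] [OpensMeasurableSpace K] {ν : Measure K} [IsFiniteMeasure ν]
    {F F' : ℝ → K → ℝ} {s : Set ℝ} (hs : IsOpen s)
    (hF : ∀ t ∈ s, ∀ k, HasDerivAt (fun t => F t k) (F' t k) t)
    (hFc : ∀ t ∈ s, Continuous (F t))
    (hF' : ContinuousOn (fun p : ℝ × K => F' p.1 p.2) (s ×ˢ univ)) {r : ℝ} (hr : r ∈ s) :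
    HasDerivAt (fun t => ∫ k, F t k ∂ν) (∫ k, F' r k ∂ν) r := by
  obtain ⟨δ, hδ, hsub⟩ := Metric.nhds_basis_closedBall.mem_iff.1 (hs.mem_nhds hr)
  obtain ⟨C, hC⟩ := ((isCompact_closedBall r δ).prod isCompact_univ).exists_bound_of_continuousOn
    (hF'.mono (prod_mono_left hsub))
  have hint : ∀ f : K → ℝ, Continuous f → Integrable f ν := fun f hf =>
    hf.integrable_of_hasCompactSupport (HasCompactSupport.of_compactSpace f)
  have hF'r : Continuous (F' r) := by
    have : ContinuousOn (F' r) univ := hF'.comp (f := fun k => (r, k)) (by fun_prop)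
      (fun k _ => ⟨hr, mem_univ k⟩)
    exact continuousOn_univ.1 this
  refine (hasDerivAt_integral_of_dominated_loc_of_deriv_le (bound := fun _ => C)
    (Metric.closedBall_mem_nhds r hδ) ?_ (hint _ (hFc r hr)) (hint _ hF'r).aestronglyMeasurable
    ?_ (integrable_const C) ?_).2
  · filter_upwards [hs.mem_nhds hr] with t ht using (hint _ (hFc t ht)).aestronglyMeasurable
  · exact .of_forall fun k t ht => hC (t, k) ⟨ht, mem_univ k⟩
  · exact .of_forall fun k t ht => hF t (hsub ht) k

lemma integrable_of_compactSpace {K : Type*} [TopologicalSpace K] [CompactSpace K]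
    [MeasurableSpace K] [OpensMeasurableSpace K] {ν : Measure K} [IsFiniteMeasure ν]
    {f : K → ℝ} (hf : Continuous f) : Integrable f ν :=
  hf.integrable_of_hasCompactSupport (HasCompactSupport.of_compactSpace f)

section Sphere

variable {E : Type*} [NormedAddCommGroup E] [InnerProductSpace ℝ E]

/-- Rotation by the angle `θ` in the plane of an orthonormal pair `e`, `f`. -/
def planeRotation (e f : E) (θ : ℝ) (y : E) : E :=
  y + ((Real.cos θ - 1) * inner ℝ e y - Real.sin θ * inner ℝ f y) • e
    + (Real.sin θ * inner ℝ e y + (Real.cos θ - 1) * inner ℝ f y) • f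

/-- The generator of the rotations in the plane of an orthonormal pair `e`, `f`. -/
def planeGenerator (e f : E) : E →L[ℝ] E :=
  (innerSL ℝ e).smulRight f - (innerSL ℝ f).smulRight e

lemma planeGenerator_apply (e f y : E) :
    planeGenerator e f y = (inner ℝ e y : ℝ) • f - (inner ℝ f y : ℝ) • e := by
  simp [planeGenerator]

lemma exists_planeRotation [FiniteDimensional ℝ E] {e f : E} (he : ‖e‖ = 1) (hf : ‖f‖ = 1)
    (hef : inner ℝ e f = (0 : ℝ)) (θ : ℝ) :
    ∃ g : E ≃ₗᵢ[ℝ] E, ∀ y, g y = planeRotation e f θ y := by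
  let L : E →ₗ[ℝ] E :=
    { toFun := planeRotation e f θ
      map_add' := fun y z => by
        simp only [planeRotation, inner_add_right]
        module
      map_smul' := fun c y => by
        simp only [planeRotation, inner_smul_right, RingHom.id_apply]
        module }
  have hL : ∀ y, ‖L y‖ = ‖y‖ := by
    intro y
    have hfe : inner ℝ f e = (0 : ℝ) := by rw [real_inner_comm]; exact hef
    rw [← sq_eq_sq₀ (norm_nonneg _) (norm_nonneg _), ← real_inner_self_eq_norm_sq,
      ← real_inner_self_eq_norm_sq]
    change inner ℝ (planeRotation e f θ y) (planeRotation e f θ y) = _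
    simp only [planeRotation, inner_add_left, inner_add_right, inner_smul_left, inner_smul_right,
      hef, hfe, real_inner_self_eq_norm_sq e, real_inner_self_eq_norm_sq f, he, hf,
      real_inner_comm e y, real_inner_comm f y, conj_trivial]
    linear_combination ((inner ℝ e y) ^ 2 + (inner ℝ f y) ^ 2 : ℝ) * Real.sin_sq_add_cos_sq θ
  exact ⟨LinearIsometry.toLinearIsometryEquiv ⟨L, hL⟩ rfl, fun y => rfl⟩

lemma hasDerivAt_planeRotation (e f y : E) (θ : ℝ) :
    HasDerivAt (fun θ => planeRotation e f θ y)
      ((-Real.sin θ * inner ℝ e y - Real.cos θ * inner ℝ f y) • e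
        + (Real.cos θ * inner ℝ e y - Real.sin θ * inner ℝ f y) • f) θ := by
  have h1 : HasDerivAt (fun θ => (Real.cos θ - 1) * inner ℝ e y - Real.sin θ * inner ℝ f y)
      (-Real.sin θ * inner ℝ e y - Real.cos θ * inner ℝ f y) θ :=
    (((Real.hasDerivAt_cos θ).sub_const 1).mul_const _).sub
      ((Real.hasDerivAt_sin θ).mul_const _)
  have h2 : HasDerivAt (fun θ => Real.sin θ * inner ℝ e y + (Real.cos θ - 1) * inner ℝ f y)
      (Real.cos θ * inner ℝ e y + -Real.sin θ * inner ℝ f y) θ :=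
    ((Real.hasDerivAt_sin θ).mul_const _).add
      (((Real.hasDerivAt_cos θ).sub_const 1).mul_const _)
  have := ((h1.smul_const e).const_add y).add (h2.smul_const f)
  refine this.congr_deriv ?_
  congr 2
  ring

variable [FiniteDimensional ℝ E] [MeasurableSpace E] [BorelSpace E]

lemma integral_toSphere_comp (g : E ≃ₗᵢ[ℝ] E) (h : E → ℝ) :
    ∫ ω, h (g ω.1) ∂(volume : Measure E).toSphere = ∫ ω, h ω.1 ∂(volume : Measure E).toSphere := by
  have hm : MeasurableEmbedding (Subtype.val : Metric.sphere (0 : E) 1 → E) :=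
    .subtype_coe Metric.isClosed_sphere.measurableSet
  rw [← hm.integral_map (fun y => h (g y)), ← hm.integral_map h]
  conv_rhs => rw [← map_toSphere_invariant g]
  exact (g.toHomeomorph.measurableEmbedding.integral_map h).symm

omit [FiniteDimensional ℝ E] [MeasurableSpace E] [BorelSpace E] in
lemma add_smul_mem_ball {x : E} {r R : ℝ} (hr : |r| < R) {w : E} (hw : ‖w‖ = 1) :
    x + r • w ∈ Metric.ball x R := by
  simpa [norm_smul, hw] using hr

/-- The integral over a sphere of an angular derivative vanishes. -/
lemma integral_fderiv_planeGenerator {e f : E} (he : ‖e‖ = 1) (hf : ‖f‖ = 1)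
    (hef : inner ℝ e f = (0 : ℝ)) {x : E} {r R : ℝ} (hr0 : 0 < r) (hrR : r < R) {g : E → ℝ}
    (hg : ContDiffOn ℝ 1 g (Metric.ball x R)) :
    ∫ ω, fderiv ℝ g (x + r • ω.1) (planeGenerator e f ω.1) ∂(volume : Measure E).toSphere = 0 := by
  have hrot : ∀ θ, ∀ ω : Metric.sphere (0 : E) 1, ‖planeRotation e f θ ω.1‖ = 1 := by
    intro θ ω
    obtain ⟨G, hG⟩ := exists_planeRotation he hf hef θ
    rw [← hG, G.norm_map]
    simp
  have hmem : ∀ θ, ∀ ω : Metric.sphere (0 : E) 1,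
      x + r • planeRotation e f θ ω.1 ∈ Metric.ball x R := fun θ ω =>
    add_smul_mem_ball (by rwa [abs_of_pos hr0]) (hrot θ ω)
  have hdiff : ∀ y ∈ Metric.ball x R, HasFDerivAt g (fderiv ℝ g y) y := fun y hy =>
    ((hg.differentiableOn one_ne_zero).differentiableAt (Metric.isOpen_ball.mem_nhds hy)).hasFDerivAt
  have hcont : ContinuousOn (fderiv ℝ g) (Metric.ball x R) :=
    hg.continuousOn_fderiv_of_isOpen Metric.isOpen_ball le_rfl
  have key := hasDerivAt_integral_of_compactSpace (ν := (volume : Measure E).toSphere)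
    (F := fun θ ω => g (x + r • planeRotation e f θ ω.1))
    (F' := fun θ ω => fderiv ℝ g (x + r • planeRotation e f θ ω.1)
      (r • ((-Real.sin θ * inner ℝ e ω.1 - Real.cos θ * inner ℝ f ω.1) • e
        + (Real.cos θ * inner ℝ e ω.1 - Real.sin θ * inner ℝ f ω.1) • f)))
    (s := univ) isOpen_univ ?_ ?_ ?_ (mem_univ 0)
  · have hconst : (fun θ => ∫ ω : Metric.sphere (0 : E) 1, g (x + r • planeRotation e f θ ω.1)
        ∂(volume : Measure E).toSphere) = fun _ => ∫ ω : Metric.sphere (0 : E) 1, g (x + r • ω.1)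
        ∂(volume : Measure E).toSphere := by
      ext θ
      obtain ⟨G, hG⟩ := exists_planeRotation he hf hef θ
      simp only [← hG]
      exact integral_toSphere_comp G (fun y => g (x + r • y))
    rw [hconst] at key
    have h0 := key.unique (hasDerivAt_const _ _)
    have : ∀ ω : Metric.sphere (0 : E) 1, planeRotation e f 0 ω.1 = ω.1 := by
      simp [planeRotation]
    simp only [this, map_smul, smul_eq_mul, integral_const_mul, mul_eq_zero, hr0.ne',
      false_or] at h0
    rw [← h0]
    refine integral_congr_ae (.of_forall fun ω => ?_)
    simp only [planeGenerator_apply, Real.sin_zero, Real.cos_zero]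
    congr 1
    module
  · intro θ _ ω
    have h := (hasDerivAt_planeRotation e f ω.1 θ).const_smul r |>.const_add x
    exact (hdiff _ (hmem θ ω)).comp_hasDerivAt θ h
  · intro θ _
    refine hg.continuousOn.comp_continuous ?_ (hmem θ)
    unfold planeRotation
    fun_prop
  · rw [univ_prod_univ, continuousOn_univ]
    refine Continuous.clm_apply ?_ (by fun_prop)
    refine hcont.comp_continuous ?_ (fun p => hmem p.1 p.2)
    unfold planeRotation
    fun_prop

lemma hasDerivAt_sphere_integral {x : E} {R : ℝ} {u : E → ℝ}
    (hu : ContDiffOn ℝ 2 u (Metric.ball x R)) {r : ℝ} (hr : |r| < R) :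
    HasDerivAt (fun t => ∫ ω, u (x + t • ω.1) ∂(volume : Measure E).toSphere)
      (∫ ω, fderiv ℝ u (x + r • ω.1) ω.1 ∂(volume : Measure E).toSphere) r := by
  have hmem : ∀ t ∈ Ioo (-R) R, ∀ ω : Metric.sphere (0 : E) 1, x + t • ω.1 ∈ Metric.ball x R :=
    fun t ht ω => add_smul_mem_ball (abs_lt.2 ht) (by simp)
  refine hasDerivAt_integral_of_compactSpace (F := fun t (ω : Metric.sphere (0 : E) 1) => u (x + t • ω.1))
    (F' := fun t (ω : Metric.sphere (0 : E) 1) => fderiv ℝ u (x + t • ω.1) ω.1) isOpen_Ioo ?_ ?_ ?_ (abs_lt.1 hr)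
  · intro t ht ω
    have h : HasDerivAt (fun t : ℝ => x + t • ω.1) ω.1 t := by
      simpa using ((hasDerivAt_id t).smul_const ω.1).const_add x
    exact ((hu.differentiableOn two_ne_zero).differentiableAt
      (Metric.isOpen_ball.mem_nhds (hmem t ht ω))).hasFDerivAt.comp_hasDerivAt t h
  · exact fun t ht => hu.continuousOn.comp_continuous (by fun_prop) (hmem t ht)
  · refine ContinuousOn.clm_apply ?_ (by fun_prop)
    exact (hu.continuousOn_fderiv_of_isOpen Metric.isOpen_ball one_le_two).comp (by fun_prop)
      fun p hp => hmem p.1 hp.1 p.2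

lemma hasDerivAt_sphere_integral_fderiv {x : E} {R : ℝ} {u : E → ℝ}
    (hu : ContDiffOn ℝ 2 u (Metric.ball x R)) {r : ℝ} (hr : |r| < R) :
    HasDerivAt (fun t => ∫ ω, fderiv ℝ u (x + t • ω.1) ω.1 ∂(volume : Measure E).toSphere)
      (∫ ω, fderiv ℝ (fderiv ℝ u) (x + r • ω.1) ω.1 ω.1 ∂(volume : Measure E).toSphere) r := by
  have hmem : ∀ t ∈ Ioo (-R) R, ∀ ω : Metric.sphere (0 : E) 1, x + t • ω.1 ∈ Metric.ball x R :=
    fun t ht ω => add_smul_mem_ball (abs_lt.2 ht) (by simp)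
  have hu1 : ContDiffOn ℝ 1 (fderiv ℝ u) (Metric.ball x R) :=
    hu.fderiv_of_isOpen Metric.isOpen_ball (by norm_num)
  refine hasDerivAt_integral_of_compactSpace (F := fun t (ω : Metric.sphere (0 : E) 1) => fderiv ℝ u (x + t • ω.1) ω.1)
    (F' := fun t (ω : Metric.sphere (0 : E) 1) => fderiv ℝ (fderiv ℝ u) (x + t • ω.1) ω.1 ω.1) isOpen_Ioo ?_ ?_ ?_ (abs_lt.1 hr)
  · intro t ht ω
    have h : HasDerivAt (fun t : ℝ => x + t • ω.1) ω.1 t := by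
      simpa using ((hasDerivAt_id t).smul_const ω.1).const_add x
    have h2 := ((hu1.differentiableOn one_ne_zero).differentiableAt
      (Metric.isOpen_ball.mem_nhds (hmem t ht ω))).hasFDerivAt.comp_hasDerivAt t h
    simpa using h2.clm_apply (hasDerivAt_const t ω.1)
  · exact fun t ht => (hu1.continuousOn.comp_continuous (by fun_prop) (hmem t ht)).clm_apply
      (by fun_prop)
  · refine ContinuousOn.clm_apply (ContinuousOn.clm_apply ?_ (by fun_prop)) (by fun_prop)
    exact (hu1.continuousOn_fderiv_of_isOpen Metric.isOpen_ball le_rfl).comp (by fun_prop)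
      fun p hp => hmem p.1 hp.1 p.2

/-- Twice the angular derivative, integrated over a sphere. -/
lemma integral_planeGenerator_sq {e f : E} (he : ‖e‖ = 1) (hf : ‖f‖ = 1)
    (hef : inner ℝ e f = (0 : ℝ)) {x : E} {r R : ℝ} (hr0 : 0 < r) (hrR : r < R) {u : E → ℝ}
    (hu : ContDiffOn ℝ 2 u (Metric.ball x R)) :
    ∫ ω, (r * fderiv ℝ (fderiv ℝ u) (x + r • ω.1) (planeGenerator e f ω.1) (planeGenerator e f ω.1)
      + fderiv ℝ u (x + r • ω.1) (planeGenerator e f (planeGenerator e f ω.1)))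
        ∂(volume : Measure E).toSphere = 0 := by
  have hu1 : ContDiffOn ℝ 1 (fderiv ℝ u) (Metric.ball x R) :=
    hu.fderiv_of_isOpen Metric.isOpen_ball (by norm_num)
  have hg : ContDiffOn ℝ 1 (fun y => fderiv ℝ u y (planeGenerator e f (y - x)))
      (Metric.ball x R) := hu1.clm_apply (by fun_prop)
  rw [← integral_fderiv_planeGenerator he hf hef hr0 hrR hg]
  refine integral_congr_ae (.of_forall fun ω => ?_)
  have hmem : x + r • ω.1 ∈ Metric.ball x R :=
    add_smul_mem_ball (by rwa [abs_of_pos hr0]) (by simp)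
  have h2 := ((hu1.differentiableOn one_ne_zero).differentiableAt
      (Metric.isOpen_ball.mem_nhds hmem)).hasFDerivAt
  have h3 : HasFDerivAt (fun y => planeGenerator e f (y - x)) (planeGenerator e f) (x + r • ω.1) :=
    (planeGenerator e f).hasFDerivAt.comp _ ((hasFDerivAt_id _).sub_const x)
  have := (h2.clm_apply h3).fderiv
  simp only [this]
  simp
  ring

end Sphere

lemma sum_planeGenerator {n : ℕ} (T : EuclideanSpace ℝ (Fin n) →L[ℝ] EuclideanSpace ℝ (Fin n) →L[ℝ] ℝ)
    (l : EuclideanSpace ℝ (Fin n) →L[ℝ] ℝ) (r : ℝ) {w : EuclideanSpace ℝ (Fin n)} (hw : ‖w‖ = 1) :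
    ∑ i : Fin n, ∑ j : Fin n,
      (r * T (planeGenerator (EuclideanSpace.single i 1) (EuclideanSpace.single j 1) w)
          (planeGenerator (EuclideanSpace.single i 1) (EuclideanSpace.single j 1) w)
        + l (planeGenerator (EuclideanSpace.single i 1) (EuclideanSpace.single j 1)
          (planeGenerator (EuclideanSpace.single i 1) (EuclideanSpace.single j 1) w)))
      = 2 * r * (∑ i : Fin n, T (EuclideanSpace.single i 1) (EuclideanSpace.single i 1) - T w w)
        - 2 * (n - 1) * l w := by
  set b : Fin n → EuclideanSpace ℝ (Fin n) := fun i => EuclideanSpace.single i 1 with hb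
  have hwsum : w = ∑ i, w i • b i := by
    ext j
    simp [hb, Finset.sum_apply, Pi.single_apply]
  have hw2 : ∑ i, w i * w i = 1 := by
    have := EuclideanSpace.real_norm_sq_eq w
    rw [hw] at this
    simp only [← sq]
    linarith
  have hlw : l w = ∑ i, w i * l (b i) := by
    conv_lhs => rw [hwsum]
    simp
  have hTw : T w w = ∑ i, ∑ j, w i * w j * T (b i) (b j) := by
    conv_lhs => rw [hwsum]
    simp only [map_sum, map_smul, sum_apply, smul_apply,
      smul_eq_mul, Finset.mul_sum]
    rw [Finset.sum_comm]
    refine Finset.sum_congr rfl fun i _ => Finset.sum_congr rfl fun j _ => by ring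
  have hJ : ∀ i j, planeGenerator (b i) (b j) w = w i • b j - w j • b i := by
    intro i j
    simp [planeGenerator_apply, hb, EuclideanSpace.inner_single_left]
  have hJJ : ∀ i j, planeGenerator (b i) (b j) (planeGenerator (b i) (b j) w)
      = ((if i = j then w i else 0) - w j) • b j - (w i - (if i = j then w j else 0)) • b i := by
    intro i j
    rw [hJ, planeGenerator_apply]
    by_cases hij : i = j
    · subst hij; simp
    · have hji : ¬ j = i := fun h => hij h.symm
      simp [hb, EuclideanSpace.inner_single_left, hij, hji]
  change ∑ i, ∑ j, (r * T (planeGenerator (b i) (b j) w) (planeGenerator (b i) (b j) w)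
    + l (planeGenerator (b i) (b j) (planeGenerator (b i) (b j) w)))
    = 2 * r * (∑ i, T (b i) (b i) - T w w) - 2 * (n - 1) * l w
  have hterm : ∀ i j, r * T (planeGenerator (b i) (b j) w) (planeGenerator (b i) (b j) w)
    + l (planeGenerator (b i) (b j) (planeGenerator (b i) (b j) w))
    = r * ((w i * w i) * T (b j) (b j)) + r * ((w j * w j) * T (b i) (b i))
      - r * (w j * w i * T (b j) (b i)) - r * (w i * w j * T (b i) (b j))
      + (if i = j then w i * l (b j) else 0) + (if i = j then w j * l (b i) else 0)
      - w j * l (b j) - w i * l (b i) := by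
    intro i j
    rw [hJJ, hJ]
    simp only [map_sub, map_smul, sub_apply, smul_apply,
      smul_eq_mul]
    split_ifs <;> ring
  simp only [hterm, Finset.sum_add_distrib, Finset.sum_sub_distrib, Finset.sum_ite_eq,
    Finset.mem_univ, if_true, ← Finset.mul_sum, Finset.sum_const, Finset.card_univ,
    Fintype.card_fin, nsmul_eq_mul]
  have e1 : ∀ c : ℝ, ∑ i, w i * w i * c = c := fun c => by rw [← Finset.sum_mul, hw2, one_mul]
  have e2 : ∑ i, ∑ j, w j * w i * T (b j) (b i) = T w w := by
    rw [hTw, Finset.sum_comm]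
  have e3 : ∑ i, w i * (n * l (b i)) = n * l w := by
    rw [hlw, Finset.mul_sum]
    exact Finset.sum_congr rfl fun i _ => by ring
  simp only [e1, e2, e3, ← hTw, ← hlw]
  ring

lemma laplacian_eq_sum {n : ℕ} {u : EuclideanSpace ℝ (Fin n) → ℝ}
    {x : EuclideanSpace ℝ (Fin n)} (hu : DifferentiableAt ℝ (fderiv ℝ u) x) :
    laplacian u x = ∑ i : Fin n, fderiv ℝ (fderiv ℝ u) x
      (EuclideanSpace.single i 1) (EuclideanSpace.single i 1) := by
  refine Finset.sum_congr rfl fun i _ => ?_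
  rw [secondDeriv, (hu.hasFDerivAt.clm_apply (hasFDerivAt_const _ _)).fderiv]
  simp

lemma continuousOn_laplacian {n : ℕ} {u : EuclideanSpace ℝ (Fin n) → ℝ}
    {s : Set (EuclideanSpace ℝ (Fin n))} (hs : IsOpen s) (hu : ContDiffOn ℝ 2 u s) :
    ContinuousOn (laplacian u) s := by
  have hu1 : ContDiffOn ℝ 1 (fderiv ℝ u) s := hu.fderiv_of_isOpen hs (by norm_num)
  have hc := hu1.continuousOn_fderiv_of_isOpen hs le_rfl
  refine ContinuousOn.congr (f := fun x => ∑ i : Fin n, fderiv ℝ (fderiv ℝ u) x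
    (EuclideanSpace.single i 1) (EuclideanSpace.single i 1)) ?_ fun x hx => laplacian_eq_sum
      ((hu1.differentiableOn one_ne_zero).differentiableAt (hs.mem_nhds hx))
  exact continuousOn_finsetSum _ fun i _ =>
    (hc.clm_apply continuousOn_const).clm_apply continuousOn_const

/-- The Euler-Poisson-Darboux equation for spherical means. -/
theorem sphere_integral_laplacian {n : ℕ} {x : EuclideanSpace ℝ (Fin n)} {r R : ℝ} (hr0 : 0 < r)
    (hrR : r < R) {u : EuclideanSpace ℝ (Fin n) → ℝ} (hu : ContDiffOn ℝ 2 u (Metric.ball x R)) :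
    r * ∫ ω, laplacian u (x + r • ω.1) ∂(volume : Measure (EuclideanSpace ℝ (Fin n))).toSphere
      = r * (∫ ω, fderiv ℝ (fderiv ℝ u) (x + r • ω.1) ω.1 ω.1
          ∂(volume : Measure (EuclideanSpace ℝ (Fin n))).toSphere)
        + (n - 1) * ∫ ω, fderiv ℝ u (x + r • ω.1) ω.1
          ∂(volume : Measure (EuclideanSpace ℝ (Fin n))).toSphere := by
  have hu1 : ContDiffOn ℝ 1 (fderiv ℝ u) (Metric.ball x R) :=
    hu.fderiv_of_isOpen Metric.isOpen_ball (by norm_num)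
  have hmem : ∀ ω : Metric.sphere (0 : EuclideanSpace ℝ (Fin n)) 1, x + r • ω.1 ∈ Metric.ball x R :=
    fun ω => add_smul_mem_ball (by rwa [abs_of_pos hr0]) (by simp)
  have c1 : Continuous fun ω : Metric.sphere (0 : EuclideanSpace ℝ (Fin n)) 1 =>
      fderiv ℝ u (x + r • ω.1) := hu1.continuousOn.comp_continuous (by fun_prop) hmem
  have c2 : Continuous fun ω : Metric.sphere (0 : EuclideanSpace ℝ (Fin n)) 1 =>
      fderiv ℝ (fderiv ℝ u) (x + r • ω.1) :=
    (hu1.continuousOn_fderiv_of_isOpen Metric.isOpen_ball le_rfl).comp_continuous (by fun_prop) hmem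
  have c3 : Continuous fun ω : Metric.sphere (0 : EuclideanSpace ℝ (Fin n)) 1 =>
      laplacian u (x + r • ω.1) :=
    (continuousOn_laplacian Metric.isOpen_ball hu).comp_continuous (by fun_prop) hmem
  have hij : ∀ i j : Fin n, ∫ ω, (r * fderiv ℝ (fderiv ℝ u) (x + r • ω.1)
        (planeGenerator (EuclideanSpace.single i 1) (EuclideanSpace.single j 1) ω.1)
        (planeGenerator (EuclideanSpace.single i 1) (EuclideanSpace.single j 1) ω.1)
      + fderiv ℝ u (x + r • ω.1)
        (planeGenerator (EuclideanSpace.single i 1) (EuclideanSpace.single j 1)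
          (planeGenerator (EuclideanSpace.single i 1) (EuclideanSpace.single j 1) ω.1)))
        ∂(volume : Measure (EuclideanSpace ℝ (Fin n))).toSphere = 0 := by
    intro i j
    by_cases h : i = j
    · subst h
      simp [planeGenerator]
    · exact integral_planeGenerator_sq (by simp) (by simp)
        (by simp [EuclideanSpace.inner_single_left, h]) hr0 hrR hu
  have hsum := Finset.sum_congr rfl fun i (_ : i ∈ Finset.univ) =>
    Finset.sum_congr rfl fun j (_ : j ∈ Finset.univ) => hij i j
  have hint : ∀ i j : Fin n, Integrable (fun ω : Metric.sphere (0 : EuclideanSpace ℝ (Fin n)) 1 =>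
      (r * fderiv ℝ (fderiv ℝ u) (x + r • ω.1)
        (planeGenerator (EuclideanSpace.single i 1) (EuclideanSpace.single j 1) ω.1)
        (planeGenerator (EuclideanSpace.single i 1) (EuclideanSpace.single j 1) ω.1)
      + fderiv ℝ u (x + r • ω.1)
        (planeGenerator (EuclideanSpace.single i 1) (EuclideanSpace.single j 1)
          (planeGenerator (EuclideanSpace.single i 1) (EuclideanSpace.single j 1) ω.1))))
      (volume : Measure (EuclideanSpace ℝ (Fin n))).toSphere := fun i j =>
    integrable_of_compactSpace (((continuous_const.mul ((c2.clm_apply (by fun_prop)).clm_apply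
      (by fun_prop)))).add (c1.clm_apply (by fun_prop)))
  simp only [← integral_finsetSum Finset.univ fun j _ => hint _ j] at hsum
  rw [← integral_finsetSum Finset.univ
    fun i _ => integrable_finsetSum Finset.univ fun j _ => hint i j] at hsum
  simp only [Finset.sum_const_zero] at hsum
  have hpt : ∀ ω : Metric.sphere (0 : EuclideanSpace ℝ (Fin n)) 1, _ := fun ω =>
    sum_planeGenerator (fderiv ℝ (fderiv ℝ u) (x + r • ω.1)) (fderiv ℝ u (x + r • ω.1)) r
      (w := ω.1) (by simp)
  simp only [hpt] at hsum
  simp only [← fun ω => laplacian_eq_sum ((hu1.differentiableOn one_ne_zero).differentiableAt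
    (Metric.isOpen_ball.mem_nhds (hmem ω)))] at hsum
  have i1 := integrable_of_compactSpace (ν := (volume : Measure (EuclideanSpace ℝ (Fin n))).toSphere) c3
  have i2 := integrable_of_compactSpace (ν := (volume : Measure (EuclideanSpace ℝ (Fin n))).toSphere)
    ((c2.clm_apply continuous_subtype_val).clm_apply continuous_subtype_val)
  have i3 := integrable_of_compactSpace (ν := (volume : Measure (EuclideanSpace ℝ (Fin n))).toSphere)
    (c1.clm_apply continuous_subtype_val)
  have i12 : Integrable (fun ω : Metric.sphere (0 : EuclideanSpace ℝ (Fin n)) 1 =>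
      laplacian u (x + r • ω.1) - fderiv ℝ (fderiv ℝ u) (x + r • ω.1) ω.1 ω.1)
      (volume : Measure (EuclideanSpace ℝ (Fin n))).toSphere := i1.sub i2
  rw [integral_sub (i12.const_mul _) (i3.const_mul _), integral_const_mul,
    integral_const_mul, integral_sub i1 i2] at hsum
  linarith

lemma summable_mul_pow_of_le_inv_factorial {c : ℕ → ℝ} (hc : ∀ m, |c m| ≤ 1 / m.factorial) (z : ℝ) :
    Summable fun m => c m * z ^ m := by
  refine Summable.of_norm_bounded (Real.summable_pow_div_factorial |z|) fun m => ?_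
  rw [norm_mul, norm_pow, Real.norm_eq_abs, Real.norm_eq_abs, div_eq_mul_one_div, mul_comm]
  exact mul_le_mul_of_nonneg_left (hc m) (by positivity)

lemma succ_mul_le_inv_factorial {c : ℕ → ℝ} (hc : ∀ m, |c m| ≤ 1 / m.factorial) (m : ℕ) :
    |((m : ℝ) + 1) * c (m + 1)| ≤ 1 / m.factorial := by
  rw [abs_mul, abs_of_pos (by positivity)]
  calc ((m : ℝ) + 1) * |c (m + 1)| ≤ (m + 1) * (1 / (m + 1).factorial) := by gcongr; exact hc _
    _ = 1 / m.factorial := by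
      rw [Nat.factorial_succ]; push_cast; field_simp

/-- Termwise differentiation of a power series with rapidly decreasing coefficients. -/
lemma hasDerivAt_tsum_mul_pow {c : ℕ → ℝ} (hc : ∀ m, |c m| ≤ 1 / m.factorial) (z : ℝ) :
    HasDerivAt (fun z => ∑' m, c m * z ^ m) (∑' m : ℕ, ((m : ℝ) + 1) * c (m + 1) * z ^ m) z := by
  set R := |z| + 1 with hR
  have hzR : z ∈ Ioo (-R) R := abs_lt.1 (by rw [hR]; linarith)
  have hs : Summable fun m : ℕ => |c m * (m * R ^ (m - 1))| := by
    rw [← summable_nat_add_iff 1]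
    have := (summable_mul_pow_of_le_inv_factorial (succ_mul_le_inv_factorial hc) R).abs
    refine this.congr fun m => ?_
    congr 1
    push_cast
    ring
  have h := hasDerivAt_tsum_of_isPreconnected (g := fun m z => c m * z ^ m)
    (g' := fun m z => c m * (m * z ^ (m - 1))) hs isOpen_Ioo isPreconnected_Ioo
    (fun m y _ => (hasDerivAt_pow m y).const_mul (c m)) (fun m y hy => ?_) hzR
    (summable_mul_pow_of_le_inv_factorial hc z) hzR
  · refine h.congr_deriv ?_
    rw [tsum_eq_zero_add']
    · simp only [CharP.cast_eq_zero, zero_mul, mul_zero, zero_add]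
      refine tsum_congr fun m => ?_
      push_cast
      ring
    · refine (summable_mul_pow_of_le_inv_factorial (succ_mul_le_inv_factorial hc) z).congr
        fun m => ?_
      push_cast
      ring
  · rw [Real.norm_eq_abs, abs_mul, abs_mul, abs_mul, abs_mul, abs_pow, abs_pow]
    have : |y| ≤ |R| := (abs_lt.2 hy).le.trans (le_abs_self R)
    gcongr

/-- The coefficients of the normalized modified Bessel function. -/
def besselCoeff (n : ℕ) (m : ℕ) : ℝ :=
  Real.Gamma ((n : ℝ) / 2) / (m.factorial * Real.Gamma ((m : ℝ) + (n : ℝ) / 2))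

/-- The normalized modified Bessel function, the reciprocal of `psi`. -/
def besselSeries (n : ℕ) (t : ℝ) : ℝ :=
  ∑' m : ℕ, besselCoeff n m * (t ^ 2 / 4) ^ m

lemma psi_eq_inv_besselSeries (n : ℕ) (t : ℝ) : psi n t = (besselSeries n t)⁻¹ := by
  simp only [psi, besselSeries, besselCoeff, mul_comm]

lemma besselCoeff_succ {n : ℕ} (hn : 2 ≤ n) (m : ℕ) :
    ((m : ℝ) + 1) * (m + n / 2) * besselCoeff n (m + 1) = besselCoeff n m := by
  have hn' : (2 : ℝ) ≤ n := by exact_mod_cast hn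
  have hpos : (0 : ℝ) < m + n / 2 := by positivity
  have hG := Real.Gamma_pos_of_pos hpos
  have h : Real.Gamma (((m + 1 : ℕ) : ℝ) + n / 2) = (m + n / 2) * Real.Gamma (m + n / 2) := by
    rw [← Real.Gamma_add_one hpos.ne']
    congr 1
    push_cast
    ring
  rw [besselCoeff, besselCoeff, h, Nat.factorial_succ]
  push_cast
  field_simp

lemma besselCoeff_zero {n : ℕ} (hn : 2 ≤ n) : besselCoeff n 0 = 1 := by
  have hn' : (2 : ℝ) ≤ n := by exact_mod_cast hn
  have hG := Real.Gamma_pos_of_pos (show (0 : ℝ) < n / 2 by positivity)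
  simp [besselCoeff, hG.ne']

lemma besselCoeff_pos {n : ℕ} (hn : 2 ≤ n) (m : ℕ) : 0 < besselCoeff n m := by
  have hn' : (2 : ℝ) ≤ n := by exact_mod_cast hn
  have h1 := Real.Gamma_pos_of_pos (show (0 : ℝ) < n / 2 by positivity)
  have h2 := Real.Gamma_pos_of_pos (show (0 : ℝ) < m + n / 2 by positivity)
  unfold besselCoeff
  positivity

lemma abs_besselCoeff_le {n : ℕ} (hn : 2 ≤ n) (m : ℕ) : |besselCoeff n m| ≤ 1 / m.factorial := by
  have hn' : (2 : ℝ) ≤ n := by exact_mod_cast hn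
  rw [abs_of_pos (besselCoeff_pos hn m)]
  induction m with
  | zero => simp [besselCoeff_zero hn]
  | succ m ih =>
    have hp := besselCoeff_pos hn (m + 1)
    have h := besselCoeff_succ hn m
    rw [← h] at ih
    rw [le_div_iff₀ (by positivity)] at ih ⊢
    rw [Nat.factorial_succ]
    push_cast
    have h1 : (1 : ℝ) ≤ m + n / 2 := by have : (0 : ℝ) ≤ m := m.cast_nonneg; linarith
    calc besselCoeff n (m + 1) * ((m + 1) * m.factorial)
        ≤ (m + n / 2) * (besselCoeff n (m + 1) * ((m + 1) * m.factorial)) :=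
          le_mul_of_one_le_left (by positivity) h1
      _ = _ := by ring
      _ ≤ 1 := ih

lemma one_le_besselSeries {n : ℕ} (hn : 2 ≤ n) (t : ℝ) : 1 ≤ besselSeries n t := by
  have h := (summable_mul_pow_of_le_inv_factorial (abs_besselCoeff_le hn) (t ^ 2 / 4)).le_tsum 0
    fun m _ => mul_nonneg (besselCoeff_pos hn m).le (by positivity)
  simpa [besselSeries, besselCoeff_zero hn] using h

lemma besselSeries_zero {n : ℕ} (hn : 2 ≤ n) : besselSeries n 0 = 1 := by
  rw [besselSeries, tsum_eq_single 0 fun m hm => by simp [hm]]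
  simp [besselCoeff_zero hn]

/-- The modified Bessel equation: the radial solution of the Yukawa equation. -/
theorem exists_deriv_besselSeries {n : ℕ} (hn : 2 ≤ n) (μ : ℝ) :
    ∃ F₁ F₂ : ℝ → ℝ, (∀ r, HasDerivAt (fun r => besselSeries n (μ * r)) (F₁ r) r) ∧
      (∀ r, HasDerivAt F₁ (F₂ r) r) ∧
      ∀ r, r * F₂ r + (n - 1) * F₁ r = r * (μ ^ 2 * besselSeries n (μ * r)) := by
  have hc := abs_besselCoeff_le hn
  have hc1 := succ_mul_le_inv_factorial hc
  have hc2 := succ_mul_le_inv_factorial hc1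
  set G : ℝ → ℝ := fun z => ∑' m, besselCoeff n m * z ^ m with hG
  set G₁ : ℝ → ℝ := fun z => ∑' m : ℕ, ((m : ℝ) + 1) * besselCoeff n (m + 1) * z ^ m with hG₁
  set G₂ : ℝ → ℝ := fun z => ∑' m : ℕ, ((m : ℝ) + 1) * (((m + 1 : ℕ) + 1 : ℝ) *
    besselCoeff n (m + 1 + 1)) * z ^ m with hG₂
  have d1 : ∀ z, HasDerivAt G (G₁ z) z := hasDerivAt_tsum_mul_pow hc
  have d2 : ∀ z, HasDerivAt G₁ (G₂ z) z := fun z => by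
    simpa [hG₁, hG₂] using hasDerivAt_tsum_mul_pow hc1 z
  have ode : ∀ z, z * G₂ z + n / 2 * G₁ z = G z := by
    intro z
    have s1 := summable_mul_pow_of_le_inv_factorial hc1 z
    have s2 : Summable fun m : ℕ => (m : ℝ) * ((m + 1) * besselCoeff n (m + 1)) * z ^ m := by
      rw [← summable_nat_add_iff 1]
      refine ((summable_mul_pow_of_le_inv_factorial hc2 z).mul_left z).congr fun m => ?_
      push_cast
      ring
    have hz : z * G₂ z = ∑' m : ℕ, (m : ℝ) * ((m + 1) * besselCoeff n (m + 1)) * z ^ m := by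
      rw [s2.tsum_eq_zero_add, hG₂, ← tsum_mul_left]
      simp only [CharP.cast_eq_zero, zero_mul, zero_add]
      refine tsum_congr fun m => ?_
      push_cast
      ring
    rw [hz, hG₁, ← tsum_mul_left, ← s2.tsum_add (s1.mul_left _)]
    refine tsum_congr fun m => ?_
    rw [← besselCoeff_succ hn m]
    ring
  have dq : ∀ r : ℝ, HasDerivAt (fun r => (μ * r) ^ 2 / 4) (μ ^ 2 * r / 2) r := fun r => by
    have := ((hasDerivAt_id r).const_mul μ).pow 2 |>.div_const 4
    refine this.congr_deriv ?_
    simp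
    ring
  refine ⟨fun r => G₁ ((μ * r) ^ 2 / 4) * (μ ^ 2 * r / 2),
    fun r => G₂ ((μ * r) ^ 2 / 4) * (μ ^ 2 * r / 2) * (μ ^ 2 * r / 2)
      + G₁ ((μ * r) ^ 2 / 4) * (μ ^ 2 / 2), fun r => ?_, fun r => ?_, fun r => ?_⟩
  · exact (d1 _).comp r (dq r)
  · have h1 := (d2 _).comp r (dq r)
    have h2 : HasDerivAt (fun r => μ ^ 2 * r / 2) (μ ^ 2 / 2) r := by
      simpa using ((hasDerivAt_id r).const_mul (μ ^ 2)).div_const 2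
    exact h1.mul h2
  · have : besselSeries n (μ * r) = G ((μ * r) ^ 2 / 4) := rfl
    rw [this, ← ode]
    ring

lemma continuous_besselSeries {n : ℕ} (hn : 2 ≤ n) (μ : ℝ) :
    Continuous fun r => besselSeries n (μ * r) := by
  obtain ⟨F₁, F₂, h, -, -⟩ := exists_deriv_besselSeries hn μ
  exact continuous_iff_continuousAt.2 fun r => (h r).continuousAt

/-- Solutions of the radial Yukawa equation regular at the origin are unique up to scale. -/
lemma eq_of_radial_ode {n : ℕ} (hn : 2 ≤ n) {c R : ℝ} {M M₁ M₂ F F₁ F₂ : ℝ → ℝ}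
    (hM : ∀ r, |r| < R → HasDerivAt M (M₁ r) r) (hM₁ : ∀ r, |r| < R → HasDerivAt M₁ (M₂ r) r)
    (hF : ∀ r, HasDerivAt F (F₁ r) r) (hF₁ : ∀ r, HasDerivAt F₁ (F₂ r) r)
    (hMode : ∀ r, 0 < r → r < R → r * M₂ r + (n - 1) * M₁ r = r * (c * M r))
    (hFode : ∀ r, 0 < r → r < R → r * F₂ r + (n - 1) * F₁ r = r * (c * F r))
    (hF0 : ∀ r, F r ≠ 0) {r : ℝ} (hr : 0 < r) (hrR : r < R) : M r / F r = M 0 / F 0 := by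
  obtain ⟨k, rfl⟩ : ∃ k, n = k + 2 := ⟨n - 2, by omega⟩
  have habs : ∀ t, 0 ≤ t → t ≤ r → |t| < R := fun t h0 h1 => by rw [abs_of_nonneg h0]; linarith
  set W : ℝ → ℝ := fun t => t ^ (k + 1) * (M₁ t * F t - M t * F₁ t) with hW
  have hWd : ∀ t, |t| < R → HasDerivAt W (((k + 1 : ℕ) : ℝ) * t ^ k * (M₁ t * F t - M t * F₁ t)
      + t ^ (k + 1) * ((M₂ t * F t + M₁ t * F₁ t) - (M₁ t * F₁ t + M t * F₂ t))) t := by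
    intro t ht
    exact (hasDerivAt_pow (k + 1) t).mul
      (((hM₁ t ht).mul (hF t)).sub ((hM t ht).mul (hF₁ t)))
  have hW0 : ∀ t, 0 < t → t ≤ r → W t = 0 := by
    intro t ht htr
    obtain ⟨s, hs, hslope⟩ := exists_hasDerivAt_eq_slope W _ ht
      (fun s hs => (hWd s (habs s hs.1 (hs.2.trans htr))).continuousAt.continuousWithinAt)
      (fun s hs => hWd s (habs s hs.1.le (hs.2.le.trans htr)))
    have e1 := hMode s hs.1 (by linarith [hs.2])
    have e2 := hFode s hs.1 (by linarith [hs.2])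
    push_cast at e1 e2 hslope
    have : ((k : ℝ) + 1) * s ^ k * (M₁ s * F s - M s * F₁ s)
      + s ^ (k + 1) * ((M₂ s * F s + M₁ s * F₁ s) - (M₁ s * F₁ s + M s * F₂ s)) = 0 := by
      linear_combination s ^ k * F s * e1 - s ^ k * M s * e2
    rw [this, eq_comm, div_eq_zero_iff] at hslope
    have hW00 : W 0 = 0 := by simp [hW]
    rcases hslope with h | h
    · linarith
    · linarith
  have hq : ∀ t, |t| < R → HasDerivAt (fun t => M t / F t)
      ((M₁ t * F t - M t * F₁ t) / F t ^ 2) t := fun t ht => (hM t ht).div (hF t) (hF0 t)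
  obtain ⟨s, hs, hslope⟩ := exists_hasDerivAt_eq_slope (fun t => M t / F t) _ hr
      (fun s hs => (hq s (habs s hs.1 hs.2)).continuousAt.continuousWithinAt)
      (fun s hs => hq s (habs s hs.1.le hs.2.le))
  have hz : M₁ s * F s - M s * F₁ s = 0 := by
    have := hW0 s hs.1 hs.2.le
    simpa [hW, hs.1.ne'] using this
  rw [hz, zero_div, eq_comm, div_eq_zero_iff] at hslope
  rcases hslope with h | h
  · linarith
  · linarith

/-- A smooth radial profile supported in the ball of radius `ε`. -/
def radialBump {E : Type*} [NormedAddCommGroup E] (ε : ℝ) (y : E) : ℝ :=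
  Real.smoothTransition (ε ^ 2 - ‖y‖ ^ 2)

lemma contDiff_radialBump {E : Type*} [NormedAddCommGroup E] [InnerProductSpace ℝ E] (ε : ℝ) :
    ContDiff ℝ 2 (radialBump ε : E → ℝ) :=
  Real.smoothTransition.contDiff.comp (contDiff_const.sub (contDiff_norm_sq ℝ))

lemma radialBump_eq_zero {E : Type*} [NormedAddCommGroup E] {ε : ℝ} (hε : 0 < ε) {y : E}
    (hy : ε ≤ ‖y‖) : radialBump ε y = 0 :=
  Real.smoothTransition.zero_of_nonpos (by nlinarith)

lemma hasCompactSupport_radialBump {E : Type*} [NormedAddCommGroup E] [ProperSpace E] {ε : ℝ}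
    (hε : 0 < ε) : HasCompactSupport (radialBump ε : E → ℝ) :=
  .intro (isCompact_closedBall 0 ε) fun y hy => radialBump_eq_zero hε (by
    simpa using (lt_of_not_ge fun h => hy (by simpa using h)).le)

section Polar

variable {E : Type*} [NormedAddCommGroup E] [InnerProductSpace ℝ E] [FiniteDimensional ℝ E]
  [MeasurableSpace E] [BorelSpace E]

/-- Functions with equal integrals over all spheres around the origin have equal integrals. -/
lemma integral_eq_of_sphere_integral_eq [Nontrivial E] {f g : E → ℝ} (hf : Integrable f) (hg : Integrable g)
    (h : ∀ r : ℝ, 0 < r → ∫ ω, f (r • ω.1) ∂(volume : Measure E).toSphere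
      = ∫ ω, g (r • ω.1) ∂(volume : Measure E).toSphere) : ∫ y, f y = ∫ y, g y := by
  set μ := (volume : Measure E)
  set κ := μ.toSphere.prod (.volumeIoiPow (Module.finrank ℝ E - 1)) with hκ
  have hmp := μ.measurePreserving_homeomorphUnitSphereProd
  have hemb := (homeomorphUnitSphereProd E).measurableEmbedding
  have hcomp : ∀ (k : E → ℝ) (y : ({(0)}ᶜ : Set E)),
      (fun p : Metric.sphere (0 : E) 1 × Ioi (0 : ℝ) => k (p.2.1 • p.1.1))
        (homeomorphUnitSphereProd E y) = k y := by
    intro k y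
    have hy : ‖(y : E)‖ ≠ 0 := norm_ne_zero_iff.2 y.2
    simp [smul_smul, hy]
  have key : ∀ k : E → ℝ, Integrable k μ → ∫ y, k y ∂μ =
      ∫ r : Ioi (0 : ℝ), ∫ ω, k (r.1 • ω.1) ∂μ.toSphere
        ∂(.volumeIoiPow (Module.finrank ℝ E - 1)) := by
    intro k hk
    have hm : MeasurableSet ({(0)}ᶜ : Set E) := (measurableSet_singleton _).compl
    have hk' : Integrable (fun y : ({(0)}ᶜ : Set E) => k y) (μ.comap (↑)) :=
      (integrableOn_iff_comap_subtypeVal hm).1 hk.integrableOn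
    have hki : Integrable (fun p : Metric.sphere (0 : E) 1 × Ioi (0 : ℝ) => k (p.2.1 • p.1.1)) κ := by
      rw [← hmp.integrable_comp_emb hemb]
      exact hk'.congr (.of_forall fun y => (hcomp k y).symm)
    calc ∫ y, k y ∂μ = ∫ y : ({(0)}ᶜ : Set E), k y ∂(μ.comap (↑)) := by
          rw [integral_subtype_comap hm k, restrict_compl_singleton]
      _ = ∫ p, k (p.2.1 • p.1.1) ∂κ := by
          rw [← hmp.integral_comp hemb]
          exact integral_congr_ae (.of_forall fun y => (hcomp k y).symm)
      _ = _ := integral_prod_symm _ hki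
  rw [key f hf, key g hg]
  exact integral_congr_ae (.of_forall fun r => h r r.2)

/-- A continuous function whose spherical means are a fixed positive function of the radius times
its value at the centre is twice continuously differentiable. -/
theorem contDiffOn_of_sphere_integral [Nontrivial E] {u : E → ℝ} {D : Set E} (hD : IsOpen D)
    (hu : ContinuousOn u D) {B : ℝ → ℝ} (hB : Continuous B) (hB0 : ∀ r, 0 < B r)
    (h : ∀ x (r : ℝ), 0 < r → Metric.closedBall x r ⊆ D →
      ∫ ω, u (x + r • ω.1) ∂(volume : Measure E).toSphere
        = u x * ((volume : Measure E).toSphere.real univ * B r)) :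
    ContDiffOn ℝ 2 u D := by
  intro x₀ hx₀
  obtain ⟨δ, hδ, hsub⟩ := Metric.nhds_basis_closedBall.mem_iff.1 (hD.mem_nhds hx₀)
  set ε := δ / 2 with hε
  have hε0 : 0 < ε := by positivity
  have hφs := hasCompactSupport_radialBump (E := E) hε0
  have hφ2 := contDiff_radialBump (E := E) ε
  set φ : E → ℝ := radialBump ε with hφ
  set w : E → ℝ := (Metric.closedBall x₀ δ).indicator u with hw
  have hwi : Integrable w :=
    ((hu.mono hsub).integrableOn_compact (isCompact_closedBall x₀ δ)).integrable_indicator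
      Metric.isClosed_closedBall.measurableSet
  have hconv := hφs.contDiff_convolution_left (ContinuousLinearMap.mul ℝ ℝ) (n := 2)
    (μ := (volume : Measure E)) hφ2 hwi.locallyIntegrable
  have hBn : Continuous fun y : E => φ y * B ‖y‖ :=
    hφ2.continuous.mul (hB.comp continuous_norm)
  have hBs : HasCompactSupport fun y : E => φ y * B ‖y‖ := hφs.mul_right
  have hC : 0 < ∫ y, φ y * B ‖y‖ := by
    refine hBn.integral_pos_of_hasCompactSupport_nonneg_nonzero hBs (x := 0)
      (fun y => mul_nonneg (Real.smoothTransition.nonneg _) (hB0 _).le) ?_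
    exact (mul_pos (Real.smoothTransition.pos_of_pos (by simp; positivity)) (hB0 _)).ne'
  have hφi : ∀ x, Integrable fun y => φ y * w (x + y) := by
    intro x
    obtain ⟨C, hC⟩ := hφs.exists_bound_of_continuous hφ2.continuous
    exact (hwi.comp_add_left x).bdd_mul hφ2.continuous.aestronglyMeasurable (.of_forall hC)
  have hmain : ∀ x ∈ Metric.ball x₀ ε,
      convolution φ w (ContinuousLinearMap.mul ℝ ℝ) volume x = u x * ∫ y, φ y * B ‖y‖ := by
    intro x hx
    have e1 : convolution φ w (ContinuousLinearMap.mul ℝ ℝ) volume x = ∫ y, φ y * w (x + y) := by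
      rw [convolution_def, ← integral_neg_eq_self]
      refine integral_congr_ae (.of_forall fun y => ?_)
      simp [hφ, radialBump]
    rw [e1, ← integral_const_mul]
    refine integral_eq_of_sphere_integral_eq (hφi x)
      ((hBn.integrable_of_hasCompactSupport hBs).const_mul _) fun r hr => ?_
    have hφr : ∀ ω : Metric.sphere (0 : E) 1, φ (r • ω.1) = Real.smoothTransition (ε ^ 2 - r ^ 2) :=
      fun ω => by simp [hφ, radialBump, norm_smul]
    have hnr : ∀ ω : Metric.sphere (0 : E) 1, ‖r • ω.1‖ = r := fun ω => by
      simp [norm_smul, abs_of_pos hr]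
    simp only [hφr, hnr, integral_const_mul, integral_const, smul_eq_mul]
    rcases le_or_gt ε r with hεr | hεr
    · rw [Real.smoothTransition.zero_of_nonpos (by nlinarith)]
      simp
    · have hball : Metric.closedBall x r ⊆ Metric.closedBall x₀ δ :=
        Metric.closedBall_subset_closedBall' (by linarith [Metric.mem_ball.1 hx])
      have hwu : ∀ ω : Metric.sphere (0 : E) 1, w (x + r • ω.1) = u (x + r • ω.1) := fun ω =>
        indicator_of_mem (hball (by simp [norm_smul, abs_of_pos hr])) u
      simp only [hwu, h x r hr (hball.trans hsub)]
      ring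
  have hev : u =ᶠ[nhds x₀] fun x =>
      (∫ y, φ y * B ‖y‖)⁻¹ * convolution φ w (ContinuousLinearMap.mul ℝ ℝ) volume x := by
    filter_upwards [Metric.ball_mem_nhds x₀ hε0] with x hx
    rw [hmain x hx]
    field_simp
  exact ((contDiff_const.mul hconv).contDiffAt.congr_of_eventuallyEq hev).contDiffWithinAt

lemma continuousAt_sphere_integral {g : E → ℝ} {x : E} {R : ℝ} (hR : 0 < R)
    (hg : ContinuousOn g (Metric.ball x R)) :
    ContinuousAt (fun t : ℝ => ∫ ω, g (x + t • ω.1) ∂(volume : Measure E).toSphere) 0 := by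
  obtain ⟨C, hC⟩ := (isCompact_closedBall x (R / 2)).exists_bound_of_continuousOn
    (hg.mono (Metric.closedBall_subset_ball (by linarith)))
  have hmem : ∀ t : ℝ, |t| < R / 2 → ∀ ω : Metric.sphere (0 : E) 1,
      x + t • ω.1 ∈ Metric.ball x (R / 2) := fun t ht ω => add_smul_mem_ball ht (by simp)
  have hsub : Metric.ball x (R / 2) ⊆ Metric.ball x R := Metric.ball_subset_ball (by linarith)
  have hev : ∀ᶠ t : ℝ in nhds 0, |t| < R / 2 := by
    filter_upwards [Metric.ball_mem_nhds (0 : ℝ) (half_pos hR)] with t ht using by simpa using ht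
  refine continuousAt_of_dominated (bound := fun _ => C) ?_ ?_ (integrable_const C) ?_
  · filter_upwards [hev] with t ht
    refine (integrable_of_compactSpace ?_).aestronglyMeasurable
    exact hg.comp_continuous (by fun_prop) fun ω => hsub (hmem t ht ω)
  · filter_upwards [hev] with t ht
    exact .of_forall fun ω => hC _ (Metric.ball_subset_closedBall (hmem t ht ω))
  · refine .of_forall fun ω => ?_
    refine ContinuousAt.comp (g := g) (f := fun t : ℝ => x + t • ω.1) ?_ (by fun_prop)
    exact hg.continuousAt (Metric.isOpen_ball.mem_nhds (by simpa using hR))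

end Polar

/-- The spherical means of a panharmonic function. -/
theorem sphere_integral_of_panharmonic {n : ℕ} (hn : 2 ≤ n) {μ : ℝ}
    {u : EuclideanSpace ℝ (Fin n) → ℝ} {x : EuclideanSpace ℝ (Fin n)} {r R : ℝ} (hr : 0 < r)
    (hrR : r < R) (hu : ContDiffOn ℝ 2 u (Metric.ball x R))
    (hlap : ∀ y ∈ Metric.ball x R, laplacian u y = μ ^ 2 * u y) :
    ∫ ω, u (x + r • ω.1) ∂(volume : Measure (EuclideanSpace ℝ (Fin n))).toSphere
      = u x * ((volume : Measure (EuclideanSpace ℝ (Fin n))).toSphere.real univ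
        * besselSeries n (μ * r)) := by
  obtain ⟨F₁, F₂, hF, hF₁, hode⟩ := exists_deriv_besselSeries hn μ
  have hF0 : ∀ r, besselSeries n (μ * r) ≠ 0 := fun r =>
    (zero_lt_one.trans_le (one_le_besselSeries hn _)).ne'
  have h := eq_of_radial_ode hn (c := μ ^ 2) (fun t ht => hasDerivAt_sphere_integral hu ht)
    (fun t ht => hasDerivAt_sphere_integral_fderiv hu ht) hF hF₁ (fun t ht htR => ?_)
    (fun t _ _ => hode t) hF0 hr hrR
  · rw [div_eq_iff (hF0 r)] at h
    rw [h]
    simp [besselSeries_zero hn]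
    ring
  · rw [← sphere_integral_laplacian ht htR hu, ← integral_const_mul (μ ^ 2)]
    congr 1
    refine integral_congr_ae (.of_forall fun ω => hlap _ ?_)
    exact add_smul_mem_ball (by rwa [abs_of_pos ht]) (by simp)

lemma toSphere_real_univ_ne_zero {n : ℕ} (hn : 1 ≤ n) :
    (volume : Measure (EuclideanSpace ℝ (Fin n))).toSphere.real univ ≠ 0 := by
  rw [Measure.toSphere_real_apply_univ, finrank_euclideanSpace, Fintype.card_fin]
  exact mul_ne_zero (Nat.cast_ne_zero.2 (by omega)) (measureReal_ne_zero_iff (by finiteness) |>.2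
    (Metric.measure_ball_pos volume _ one_pos).ne')

/-- The infinitesimal form of the average property. -/
theorem laplacian_of_sphere_integral {n : ℕ} (hn : 2 ≤ n) {μ : ℝ}
    {u : EuclideanSpace ℝ (Fin n) → ℝ} {x : EuclideanSpace ℝ (Fin n)} {R : ℝ} (hR : 0 < R)
    (hu : ContDiffOn ℝ 2 u (Metric.ball x R))
    (h : ∀ r, 0 < r → r < R →
      ∫ ω, u (x + r • ω.1) ∂(volume : Measure (EuclideanSpace ℝ (Fin n))).toSphere
        = u x * ((volume : Measure (EuclideanSpace ℝ (Fin n))).toSphere.real univ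
          * besselSeries n (μ * r))) :
    laplacian u x = μ ^ 2 * u x := by
  have : Nonempty (Fin n) := ⟨⟨0, by omega⟩⟩
  obtain ⟨F₁, F₂, hF, hF₁, hode⟩ := exists_deriv_besselSeries hn μ
  set τ := (volume : Measure (EuclideanSpace ℝ (Fin n))).toSphere with hτ
  have hτ0 : τ.real univ ≠ 0 := toSphere_real_univ_ne_zero (by omega)
  set k := u x * τ.real univ with hk
  have habs : ∀ r ∈ Ioo 0 R, |r| < R := fun r hr => by rw [abs_of_pos hr.1]; exact hr.2
  have e1 : ∀ r ∈ Ioo 0 R, ∫ ω, fderiv ℝ u (x + r • ω.1) ω.1 ∂τ = k * F₁ r := by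
    intro r hr
    refine (hasDerivAt_sphere_integral hu (habs r hr)).unique
      (((hF r).const_mul k).congr_of_eventuallyEq ?_)
    filter_upwards [isOpen_Ioo.mem_nhds hr] with t ht
    rw [h t ht.1 ht.2, hk, mul_assoc]
  have e2 : ∀ r ∈ Ioo 0 R, ∫ ω, fderiv ℝ (fderiv ℝ u) (x + r • ω.1) ω.1 ω.1 ∂τ = k * F₂ r := by
    intro r hr
    refine (hasDerivAt_sphere_integral_fderiv hu (habs r hr)).unique
      (((hF₁ r).const_mul k).congr_of_eventuallyEq ?_)
    filter_upwards [isOpen_Ioo.mem_nhds hr] with t ht using e1 t ht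
  have e3 : ∀ r ∈ Ioo 0 R, ∫ ω, laplacian u (x + r • ω.1) ∂τ
      = k * (μ ^ 2 * besselSeries n (μ * r)) := by
    intro r hr
    have := sphere_integral_laplacian hr.1 hr.2 hu
    rw [e1 r hr, e2 r hr] at this
    refine mul_left_cancel₀ hr.1.ne' (this.trans ?_)
    linear_combination k * hode r
  have l1 := (continuousAt_sphere_integral hR
    (continuousOn_laplacian Metric.isOpen_ball hu)).tendsto.mono_left
      (nhdsWithin_le_nhds (s := Ioi (0 : ℝ)))
  have l2 := (((continuous_besselSeries hn μ).const_mul (μ ^ 2)).const_mul k).tendsto 0 |>.mono_left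
      (nhdsWithin_le_nhds (s := Ioi (0 : ℝ)))
  have hl := tendsto_nhds_unique_of_eventuallyEq l1 l2 (by
    filter_upwards [Ioo_mem_nhdsGT hR] with r hr using e3 r hr)
  simp only [zero_smul, add_zero, integral_const, smul_eq_mul, mul_zero, besselSeries_zero hn,
    mul_one, hk] at hl
  refine mul_left_cancel₀ hτ0 (hl.trans ?_)
  ring

/-- **Characterization of panharmonic functions by the average property.**
Let `D ⊆ ℝⁿ` (`n ≥ 2`) be open, `μ > 0`, and let `u : D → ℝ` be continuous.  Then `u`
is `μ`-panharmonic on `D` (twice continuously differentiable with `Δu = μ²u` on `D`)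
if and only if for every `x ∈ D` and `r > 0` with `B̄(x,r) ⊆ D`,
`u(x) = ψ_n(μr) ∫_{∂B(x,r)} u dσ`. -/
theorem panharmonic_iff_average (n : ℕ) (hn : 2 ≤ n)
    (D : Set (EuclideanSpace ℝ (Fin n))) (hD : IsOpen D)
    (μ : ℝ) (hμ : 0 < μ)
    (u : EuclideanSpace ℝ (Fin n) → ℝ)
    (hu : ContinuousOn u D) :
    (ContDiffOn ℝ 2 u D ∧ ∀ x ∈ D, laplacian u x = μ ^ 2 * u x) ↔
      (∀ (x : EuclideanSpace ℝ (Fin n)) (r : ℝ), x ∈ D → 0 < r →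
        Metric.closedBall x r ⊆ D →
        u x = psi n (μ * r) * ∫ y, u y ∂(sphereUniform n x r)) := by
  have : Nonempty (Fin n) := ⟨⟨0, by omega⟩⟩
  have hτ0 := toSphere_real_univ_ne_zero (n := n) (by omega)
  have hF0 : ∀ t, 0 < besselSeries n t := fun t => zero_lt_one.trans_le (one_le_besselSeries hn t)
  have hiff : ∀ x r, 0 < r → (u x = psi n (μ * r) * ∫ y, u y ∂(sphereUniform n x r) ↔
      ∫ ω, u (x + r • ω.1) ∂(volume : Measure (EuclideanSpace ℝ (Fin n))).toSphere
        = u x * ((volume : Measure (EuclideanSpace ℝ (Fin n))).toSphere.real univ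
          * besselSeries n (μ * r))) := by
    intro x r hr
    rw [psi_eq_inv_besselSeries, integral_sphereUniform (by omega) x hr, ← mul_assoc, ← mul_inv,
      eq_inv_mul_iff_mul_eq₀ (mul_ne_zero (hF0 _).ne' hτ0), eq_comm,
      mul_comm (besselSeries n (μ * r)), mul_comm (u x)]
  constructor
  · rintro ⟨h2, hlap⟩ x r hx hr hsub
    obtain ⟨δ, hδ, hδD⟩ := (isCompact_closedBall x r).exists_thickening_subset_open hD hsub
    rw [thickening_closedBall hδ hr.le] at hδD
    exact (hiff x r hr).2 (sphere_integral_of_panharmonic hn hr (by linarith) (h2.mono hδD)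
      fun y hy => hlap y (hδD hy))
  · intro h
    have h' : ∀ x r, 0 < r → Metric.closedBall x r ⊆ D → _ := fun x r hr hsub =>
      (hiff x r hr).1 (h x r (hsub (Metric.mem_closedBall_self hr.le)) hr hsub)
    have h2 := contDiffOn_of_sphere_integral hD hu (continuous_besselSeries hn μ)
      (fun r => hF0 _) h'
    refine ⟨h2, fun x hx => ?_⟩
    obtain ⟨R, hR, hsub⟩ := Metric.isOpen_iff.1 hD x hx
    exact laplacian_of_sphere_integral hn hR (h2.mono hsub) fun r hr hrR =>
      h' x r hr ((Metric.closedBall_subset_ball hrR).trans hsub)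

end
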